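/- Let G be a spray on an open set U ⊆ ℝⁿ (n ≥ 2), dV = σ(x) dx¹⋯dxⁿ a volume form on U with S-curvature S, and Ĝⁱ := Gⁱ − (S/(n+1)) yⁱ the associated spray. Then the Riemann curvature R̂ⁱ_k of Ĝ is given by R̂ⁱ_k = Rⁱ_k + τ δⁱ_k − (1/2) τ_{·k} yⁱ + (3 χ_k/(n+1)) yⁱ, where τ := ( S/(n+1) )² + (1/(n+1)) S_{|m} y^m, with S_{|m} y^m := y^m ( ∂S/∂x^m − N^p_m ∂S/∂y^p ), and where R̂ⁱ_k is computed from Ĝ by the same formulas as Rⁱ_k is computed from G. -/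

import Mathlib

open scoped BigOperators

noncomputable section

/-- Points/vectors in local coordinates on an open subset of `ℝⁿ`. -/
abbrev Vec (n : ℕ) := Fin n → ℝ

variable {n : ℕ}

/-- Partial derivative in the base (`x`) variable, in the `k`-th coordinate direction. -/
noncomputable def pdx (f : Vec n → Vec n → ℝ) (k : Fin n) (x y : Vec n) : ℝ :=
  fderiv ℝ (fun x' => f x' y) x (Pi.single k 1)

/-- Partial derivative in the fiber (`y`) variable, in the `k`-th coordinate direction;
this is the operation denoted by a subscript `·k`. -/
noncomputable def pdy (f : Vec n → Vec n → ℝ) (k : Fin n) (x y : Vec n) : ℝ :=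
  fderiv ℝ (fun y' => f x y') y (Pi.single k 1)

/-- Partial derivative of a function of `x` alone. -/
noncomputable def pd (f : Vec n → ℝ) (k : Fin n) (x : Vec n) : ℝ :=
  fderiv ℝ f x (Pi.single k 1)

/-- `G` is a spray on the open set `U ⊆ ℝⁿ`: the coefficients `Gⁱ(x,y)` are smooth for
`x ∈ U`, `y ≠ 0`, and positively homogeneous of degree `2` in `y`. -/
def IsSpray (U : Set (Vec n)) (G : Fin n → Vec n → Vec n → ℝ) : Prop :=
  (∀ i, ContDiffOn ℝ (⊤ : ℕ∞) (fun p : Vec n × Vec n => G i p.1 p.2)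
      (U ×ˢ {y : Vec n | y ≠ 0})) ∧
  (∀ i (x y : Vec n) (lam : ℝ), 0 < lam → G i x (lam • y) = lam ^ 2 * G i x y)

/-- `N^i_j := ∂G^i/∂y^j`. -/
noncomputable def Nc (G : Fin n → Vec n → Vec n → ℝ) (i j : Fin n) (x y : Vec n) : ℝ :=
  pdy (G i) j x y

/-- `Γ^i_{jk} := ∂²G^i/∂y^j∂y^k`. -/
noncomputable def Ga (G : Fin n → Vec n → Vec n → ℝ) (i j k : Fin n) (x y : Vec n) : ℝ :=
  pdy (Nc G i j) k x y

/-- The horizontal derivative `δf/δx^k := ∂f/∂x^k − N^m_k ∂f/∂y^m`; for a scalar `f` this is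
also the horizontal covariant derivative `f_{|k}`. -/
noncomputable def hd (G : Fin n → Vec n → Vec n → ℝ) (f : Vec n → Vec n → ℝ)
    (k : Fin n) (x y : Vec n) : ℝ :=
  pdx f k x y - ∑ m, Nc G m k x y * pdy f m x y

/-- The four-index Riemann curvature tensor
`R_j{}^i{}_{kl} := δΓⁱ_{jl}/δx^k − δΓⁱ_{jk}/δx^l + Γⁱ_{ks}Γ^s_{jl} − Γ^s_{jk}Γⁱ_{ls}`. -/
noncomputable def Riem4 (G : Fin n → Vec n → Vec n → ℝ) (j i k l : Fin n)
    (x y : Vec n) : ℝ :=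
  hd G (Ga G i j l) k x y - hd G (Ga G i j k) l x y
    + ∑ s, (Ga G i k s x y * Ga G s j l x y - Ga G s j k x y * Ga G i l s x y)

/-- The two-index Riemann curvature `R^i_k := y^j R_j{}^i{}_{kl} y^l`. -/
noncomputable def Riem2 (G : Fin n → Vec n → Vec n → ℝ) (i k : Fin n)
    (x y : Vec n) : ℝ :=
  ∑ j, ∑ l, y j * Riem4 G j i k l x y * y l

/-- The χ-curvature `χ_k := −(1/6)(2 R^m_{k·m} + R^m_{m·k})`. -/
noncomputable def chi (G : Fin n → Vec n → Vec n → ℝ) (k : Fin n) (x y : Vec n) : ℝ :=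
  -(1 / 6) * (2 * ∑ m, pdy (Riem2 G m k) m x y + ∑ m, pdy (Riem2 G m m) k x y)

/-- The scalar `R := (1/(n−1)) R^m_m`. -/
noncomputable def Rsc (G : Fin n → Vec n → Vec n → ℝ) (x y : Vec n) : ℝ :=
  (1 / ((n : ℝ) - 1)) * ∑ m, Riem2 G m m x y

/-- `Π := ∂G^m/∂y^m`. -/
noncomputable def PiG (G : Fin n → Vec n → Vec n → ℝ) (x y : Vec n) : ℝ :=
  ∑ m, Nc G m m x y

/-- The S-curvature of `(G, dV)` for the volume form `dV = σ(x) dx¹⋯dxⁿ`: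
`S := Π − y^m ∂(ln σ)/∂x^m`. -/
noncomputable def Scurv (G : Fin n → Vec n → Vec n → ℝ) (σ : Vec n → ℝ)
    (x y : Vec n) : ℝ :=
  PiG G x y - ∑ m, y m * pd (fun x' => Real.log (σ x')) m x

/-- The spray `Ĝ` associated with `(G, dV)`: `Ĝⁱ := Gⁱ − (S/(n+1)) yⁱ`. -/
noncomputable def Ghat (G : Fin n → Vec n → Vec n → ℝ) (σ : Vec n → ℝ)
    (i : Fin n) (x y : Vec n) : ℝ :=
  G i x y - (Scurv G σ x y / ((n : ℝ) + 1)) * y i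

/-- `σ` is the (positive, smooth) density of a volume form `dV = σ(x) dx¹⋯dxⁿ` on `U`. -/
def IsVolumeForm (U : Set (Vec n)) (σ : Vec n → ℝ) : Prop :=
  ContDiffOn ℝ (⊤ : ℕ∞) σ U ∧ ∀ x ∈ U, 0 < σ x

/-- `G` is of isotropic curvature on `U`: `Rⁱ_k = R δⁱ_k − (1/2) R_{·k} yⁱ`. -/
def IsIsotropicCurv (U : Set (Vec n)) (G : Fin n → Vec n → Vec n → ℝ) : Prop :=
  ∀ x ∈ U, ∀ y : Vec n, y ≠ 0 → ∀ i k,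
    Riem2 G i k x y
      = Rsc G x y * (if i = k then 1 else 0) - (1 / 2) * pdy (Rsc G) k x y * y i

/-- `G` is of scalar curvature on `U`: `Rⁱ_k = R δⁱ_k − τ_k yⁱ` for some functions `τ_k`,
positively homogeneous of degree one in `y`, with `τ_k y^k = R`. -/
def IsScalarCurv (U : Set (Vec n)) (G : Fin n → Vec n → Vec n → ℝ) : Prop :=
  ∃ τ : Fin n → Vec n → Vec n → ℝ,
    (∀ k (x y : Vec n) (lam : ℝ), 0 < lam → τ k x (lam • y) = lam * τ k x y) ∧
    ∀ x ∈ U, ∀ y : Vec n, y ≠ 0 →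
      (∑ k, τ k x y * y k) = Rsc G x y ∧
      ∀ i k, Riem2 G i k x y
        = Rsc G x y * (if i = k then 1 else 0) - τ k x y * y i

/-- `f` is smooth on the slit domain `U × (ℝⁿ \ {0})`. -/
def SlitSmooth (U : Set (Vec n)) (f : Vec n → Vec n → ℝ) : Prop :=
  ContDiffOn ℝ (⊤ : ℕ∞) (fun p : Vec n × Vec n => f p.1 p.2) (U ×ˢ {y : Vec n | y ≠ 0})

/-- Euler's identity `y^m f_{·m} = d f` on the slit domain. -/
def EulerHom (U : Set (Vec n)) (d : ℝ) (f : Vec n → Vec n → ℝ) : Prop :=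
  ∀ x ∈ U, ∀ y : Vec n, y ≠ 0 → ∑ m, y m * pdy f m x y = d * f x y

/-- `f` and `g` agree on the slit domain. -/
def SlitEq (U : Set (Vec n)) (f g : Vec n → Vec n → ℝ) : Prop :=
  ∀ x ∈ U, ∀ y : Vec n, y ≠ 0 → f x y = g x y

section SlitCalculus

variable {U : Set (Vec n)} {f g : Vec n → Vec n → ℝ} {x y : Vec n}

lemma isOpen_slit (hU : IsOpen U) : IsOpen (U ×ˢ {y : Vec n | y ≠ 0}) :=
  hU.prod isOpen_ne

lemma SlitEq.pdx (hU : IsOpen U) (h : SlitEq U f g) (k : Fin n) :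
    SlitEq U (pdx f k) (pdx g k) := by
  intro x hx y hy
  unfold _root_.pdx
  have : (fun x' => f x' y) =ᶠ[nhds x] fun x' => g x' y := by
    filter_upwards [hU.mem_nhds hx] with x' hx' using h x' hx' y hy
  rw [this.fderiv_eq]

lemma SlitEq.pdy (h : SlitEq U f g) (k : Fin n) : SlitEq U (pdy f k) (pdy g k) := by
  intro x hx y hy
  unfold _root_.pdy
  have : (fun y' => f x y') =ᶠ[nhds y] fun y' => g x y' := by
    filter_upwards [isOpen_ne.mem_nhds hy] with y' hy' using h x hx y' hy'
  rw [this.fderiv_eq]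

lemma SlitSmooth.congr (hf : SlitSmooth U f) (h : SlitEq U g f) : SlitSmooth U g :=
  ContDiffOn.congr hf fun p hp => h p.1 hp.1 p.2 hp.2

lemma SlitSmooth.contDiffAt (hU : IsOpen U) (hf : SlitSmooth U f) (hx : x ∈ U) (hy : y ≠ 0) :
    ContDiffAt ℝ (⊤ : ℕ∞) (fun p : Vec n × Vec n => f p.1 p.2) (x, y) :=
  ContDiffOn.contDiffAt hf ((isOpen_slit hU).mem_nhds ⟨hx, hy⟩)

lemma SlitSmooth.differentiableAt (hU : IsOpen U) (hf : SlitSmooth U f) (hx : x ∈ U)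
    (hy : y ≠ 0) : DifferentiableAt ℝ (fun p : Vec n × Vec n => f p.1 p.2) (x, y) :=
  (hf.contDiffAt hU hx hy).differentiableAt (by simp)

lemma SlitSmooth.hasFDerivAt_left (hU : IsOpen U) (hf : SlitSmooth U f) (hx : x ∈ U)
    (hy : y ≠ 0) :
    HasFDerivAt (fun x' => f x' y) ((fderiv ℝ (fun p : Vec n × Vec n => f p.1 p.2) (x, y)).comp
      (ContinuousLinearMap.inl ℝ (Vec n) (Vec n))) x :=
  HasFDerivAt.comp (g := fun p : Vec n × Vec n => f p.1 p.2) (f := fun x' => (x', y)) x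
    (hf.differentiableAt hU hx hy).hasFDerivAt (hasFDerivAt_prodMk_left x y)

lemma SlitSmooth.hasFDerivAt_right (hU : IsOpen U) (hf : SlitSmooth U f) (hx : x ∈ U)
    (hy : y ≠ 0) :
    HasFDerivAt (fun y' => f x y') ((fderiv ℝ (fun p : Vec n × Vec n => f p.1 p.2) (x, y)).comp
      (ContinuousLinearMap.inr ℝ (Vec n) (Vec n))) y :=
  HasFDerivAt.comp (g := fun p : Vec n × Vec n => f p.1 p.2) (f := fun y' => (x, y')) y
    (hf.differentiableAt hU hx hy).hasFDerivAt (hasFDerivAt_prodMk_right x y)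

lemma SlitSmooth.differentiableAt_left (hU : IsOpen U) (hf : SlitSmooth U f) (hx : x ∈ U)
    (hy : y ≠ 0) : DifferentiableAt ℝ (fun x' => f x' y) x :=
  (hf.hasFDerivAt_left hU hx hy).differentiableAt

lemma SlitSmooth.differentiableAt_right (hU : IsOpen U) (hf : SlitSmooth U f) (hx : x ∈ U)
    (hy : y ≠ 0) : DifferentiableAt ℝ (fun y' => f x y') y :=
  (hf.hasFDerivAt_right hU hx hy).differentiableAt

lemma SlitSmooth.pdx_eq (hU : IsOpen U) (hf : SlitSmooth U f) (k : Fin n) :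
    SlitEq U (pdx f k) fun x y =>
      fderiv ℝ (fun p : Vec n × Vec n => f p.1 p.2) (x, y) (Pi.single k 1, 0) := by
  intro x hx y hy
  simp [pdx, (hf.hasFDerivAt_left hU hx hy).fderiv]

lemma SlitSmooth.pdy_eq (hU : IsOpen U) (hf : SlitSmooth U f) (k : Fin n) :
    SlitEq U (pdy f k) fun x y =>
      fderiv ℝ (fun p : Vec n × Vec n => f p.1 p.2) (x, y) (0, Pi.single k 1) := by
  intro x hx y hy
  simp [pdy, (hf.hasFDerivAt_right hU hx hy).fderiv]

lemma SlitSmooth.fderiv_apply (hU : IsOpen U) (hf : SlitSmooth U f) (v : Vec n × Vec n) :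
    SlitSmooth U fun x y => fderiv ℝ (fun p : Vec n × Vec n => f p.1 p.2) (x, y) v := by
  have h : ContDiffOn ℝ (⊤ : ℕ∞) (fderiv ℝ (fun p : Vec n × Vec n => f p.1 p.2))
      (U ×ˢ {y : Vec n | y ≠ 0}) :=
    ContDiffOn.fderiv_of_isOpen hf (isOpen_slit hU) (by simp)
  exact h.clm_apply contDiffOn_const

lemma SlitSmooth.pdx (hU : IsOpen U) (hf : SlitSmooth U f) (k : Fin n) :
    SlitSmooth U (pdx f k) :=
  (hf.fderiv_apply hU _).congr (hf.pdx_eq hU k)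

lemma SlitSmooth.pdy (hU : IsOpen U) (hf : SlitSmooth U f) (k : Fin n) :
    SlitSmooth U (pdy f k) :=
  (hf.fderiv_apply hU _).congr (hf.pdy_eq hU k)

lemma SlitSmooth.fderiv_fderiv_comm (hU : IsOpen U) (hf : SlitSmooth U f) (hx : x ∈ U)
    (hy : y ≠ 0) (v w : Vec n × Vec n) :
    fderiv ℝ (fun p => fderiv ℝ (fun p : Vec n × Vec n => f p.1 p.2) p v) (x, y) w
      = fderiv ℝ (fun p => fderiv ℝ (fun p : Vec n × Vec n => f p.1 p.2) p w) (x, y) v := by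
  have hc := hf.contDiffAt hU hx hy
  have hd : DifferentiableAt ℝ (fderiv ℝ (fun p : Vec n × Vec n => f p.1 p.2)) (x, y) :=
    (hc.fderiv_right (m := 1) (by norm_cast)).differentiableAt (by simp)
  have hs : IsSymmSndFDerivAt ℝ (fun p : Vec n × Vec n => f p.1 p.2) (x, y) :=
    hc.isSymmSndFDerivAt (by
    rw [minSmoothness_of_isRCLikeNormedField]
    exact WithTop.coe_le_coe.2 (le_top : (2 : ℕ∞) ≤ ⊤))
  rw [fderiv_clm_apply hd (differentiableAt_const v),
    fderiv_clm_apply hd (differentiableAt_const w)]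
  simpa using hs w v

lemma pdy_pdx_comm (hU : IsOpen U) (hf : SlitSmooth U f) (j k : Fin n) :
    SlitEq U (pdy (pdx f j) k) (pdx (pdy f k) j) := by
  intro x hx y hy
  rw [(hf.pdx_eq hU j).pdy k x hx y hy, (hf.pdy_eq hU k).pdx hU j x hx y hy,
    (hf.fderiv_apply hU _).pdy_eq hU k x hx y hy, (hf.fderiv_apply hU _).pdx_eq hU j x hx y hy]
  exact hf.fderiv_fderiv_comm hU hx hy _ _

lemma pdy_pdy_comm (hU : IsOpen U) (hf : SlitSmooth U f) (j k : Fin n) :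
    SlitEq U (pdy (pdy f j) k) (pdy (pdy f k) j) := by
  intro x hx y hy
  rw [(hf.pdy_eq hU j).pdy k x hx y hy, (hf.pdy_eq hU k).pdy j x hx y hy,
    (hf.fderiv_apply hU _).pdy_eq hU k x hx y hy, (hf.fderiv_apply hU _).pdy_eq hU j x hx y hy]
  exact hf.fderiv_fderiv_comm hU hx hy _ _

lemma pdx_pdx_comm (hU : IsOpen U) (hf : SlitSmooth U f) (j k : Fin n) :
    SlitEq U (pdx (pdx f j) k) (pdx (pdx f k) j) := by
  intro x hx y hy
  rw [(hf.pdx_eq hU j).pdx hU k x hx y hy, (hf.pdx_eq hU k).pdx hU j x hx y hy,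
    (hf.fderiv_apply hU _).pdx_eq hU k x hx y hy, (hf.fderiv_apply hU _).pdx_eq hU j x hx y hy]
  exact hf.fderiv_fderiv_comm hU hx hy _ _

lemma SlitSmooth.const (c : ℝ) : SlitSmooth U fun _ _ => c := contDiffOn_const

lemma SlitSmooth.coord (i : Fin n) : SlitSmooth U fun _ y => y i :=
  ((contDiff_apply ℝ ℝ i).comp contDiff_snd).contDiffOn

lemma SlitSmooth.add (hf : SlitSmooth U f) (hg : SlitSmooth U g) :
    SlitSmooth U fun x y => f x y + g x y := ContDiffOn.add hf hg

lemma SlitSmooth.sub (hf : SlitSmooth U f) (hg : SlitSmooth U g) :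
    SlitSmooth U fun x y => f x y - g x y := ContDiffOn.sub hf hg

lemma SlitSmooth.mul (hf : SlitSmooth U f) (hg : SlitSmooth U g) :
    SlitSmooth U fun x y => f x y * g x y := ContDiffOn.mul hf hg

lemma SlitSmooth.sum {F : Fin n → Vec n → Vec n → ℝ} (hF : ∀ m, SlitSmooth U (F m)) :
    SlitSmooth U fun x y => ∑ m, F m x y :=
  ContDiffOn.sum (f := fun m (p : Vec n × Vec n) => F m p.1 p.2) fun m _ => hF m

lemma pdy_add (hU : IsOpen U) (hf : SlitSmooth U f) (hg : SlitSmooth U g) (k : Fin n)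
    (hx : x ∈ U) (hy : y ≠ 0) :
    pdy (fun x y => f x y + g x y) k x y = pdy f k x y + pdy g k x y := by
  simp only [pdy]
  rw [fderiv_fun_add (hf.differentiableAt_right hU hx hy) (hg.differentiableAt_right hU hx hy)]
  rfl

lemma pdy_sub (hU : IsOpen U) (hf : SlitSmooth U f) (hg : SlitSmooth U g) (k : Fin n)
    (hx : x ∈ U) (hy : y ≠ 0) :
    pdy (fun x y => f x y - g x y) k x y = pdy f k x y - pdy g k x y := by
  simp only [pdy]
  rw [fderiv_fun_sub (hf.differentiableAt_right hU hx hy) (hg.differentiableAt_right hU hx hy)]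
  rfl

lemma pdy_mul (hU : IsOpen U) (hf : SlitSmooth U f) (hg : SlitSmooth U g) (k : Fin n)
    (hx : x ∈ U) (hy : y ≠ 0) :
    pdy (fun x y => f x y * g x y) k x y = pdy f k x y * g x y + f x y * pdy g k x y := by
  simp only [pdy]
  rw [fderiv_fun_mul (hf.differentiableAt_right hU hx hy) (hg.differentiableAt_right hU hx hy)]
  simp only [add_apply, smul_apply, smul_eq_mul]
  ring

lemma pdy_const (c : ℝ) (k : Fin n) : pdy (fun _ _ => c) k x y = 0 := by
  simp [pdy]

lemma pdy_coord (i k : Fin n) :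
    pdy (fun _ y => y i) k x y = if i = k then 1 else 0 := by
  have h : fderiv ℝ (fun y' : Vec n => y' i) y
      = (ContinuousLinearMap.proj i : Vec n →L[ℝ] ℝ) :=
    (ContinuousLinearMap.proj i : Vec n →L[ℝ] ℝ).fderiv
  simp [pdy, h, Pi.single_apply]

lemma pdy_const_mul (hU : IsOpen U) (c : ℝ) (hf : SlitSmooth U f) (k : Fin n)
    (hx : x ∈ U) (hy : y ≠ 0) :
    pdy (fun x y => c * f x y) k x y = c * pdy f k x y := by
  rw [pdy_mul hU (SlitSmooth.const c) hf k hx hy, pdy_const]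
  ring

lemma pdy_sum (hU : IsOpen U) {F : Fin n → Vec n → Vec n → ℝ} (hF : ∀ m, SlitSmooth U (F m))
    (k : Fin n) (hx : x ∈ U) (hy : y ≠ 0) :
    pdy (fun x y => ∑ m, F m x y) k x y = ∑ m, pdy (F m) k x y := by
  simp only [pdy]
  rw [fderiv_fun_sum fun m _ => (hF m).differentiableAt_right hU hx hy]
  simp

lemma pdx_add (hU : IsOpen U) (hf : SlitSmooth U f) (hg : SlitSmooth U g) (k : Fin n)
    (hx : x ∈ U) (hy : y ≠ 0) :
    pdx (fun x y => f x y + g x y) k x y = pdx f k x y + pdx g k x y := by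
  simp only [pdx]
  rw [fderiv_fun_add (hf.differentiableAt_left hU hx hy) (hg.differentiableAt_left hU hx hy)]
  rfl

lemma pdx_sub (hU : IsOpen U) (hf : SlitSmooth U f) (hg : SlitSmooth U g) (k : Fin n)
    (hx : x ∈ U) (hy : y ≠ 0) :
    pdx (fun x y => f x y - g x y) k x y = pdx f k x y - pdx g k x y := by
  simp only [pdx]
  rw [fderiv_fun_sub (hf.differentiableAt_left hU hx hy) (hg.differentiableAt_left hU hx hy)]
  rfl

lemma pdx_mul (hU : IsOpen U) (hf : SlitSmooth U f) (hg : SlitSmooth U g) (k : Fin n)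
    (hx : x ∈ U) (hy : y ≠ 0) :
    pdx (fun x y => f x y * g x y) k x y = pdx f k x y * g x y + f x y * pdx g k x y := by
  simp only [pdx]
  rw [fderiv_fun_mul (hf.differentiableAt_left hU hx hy) (hg.differentiableAt_left hU hx hy)]
  simp only [add_apply, smul_apply, smul_eq_mul]
  ring

lemma pdx_fiber (h : Vec n → ℝ) (k : Fin n) : pdx (fun _ y => h y) k x y = 0 := by
  simp [pdx]

lemma pdx_const_mul (hU : IsOpen U) (c : ℝ) (hf : SlitSmooth U f) (k : Fin n)
    (hx : x ∈ U) (hy : y ≠ 0) :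
    pdx (fun x y => c * f x y) k x y = c * pdx f k x y := by
  rw [pdx_mul hU (SlitSmooth.const c) hf k hx hy, pdx_fiber (fun _ => c)]
  ring

lemma pdx_sum (hU : IsOpen U) {F : Fin n → Vec n → Vec n → ℝ} (hF : ∀ m, SlitSmooth U (F m))
    (k : Fin n) (hx : x ∈ U) (hy : y ≠ 0) :
    pdx (fun x y => ∑ m, F m x y) k x y = ∑ m, pdx (F m) k x y := by
  simp only [pdx]
  rw [fderiv_fun_sum fun m _ => (hF m).differentiableAt_left hU hx hy]
  simp

lemma EulerHom.pdy (hU : IsOpen U) {d : ℝ} (hf : SlitSmooth U f) (h : EulerHom U d f)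
    (k : Fin n) : EulerHom U (d - 1) (pdy f k) := by
  intro x hx y hy
  have e := SlitEq.pdy (f := fun x y => ∑ m, y m * _root_.pdy f m x y)
    (g := fun x y => d * f x y) h k x hx y hy
  rw [pdy_sum hU (fun m => (SlitSmooth.coord m).mul (hf.pdy hU m)) k hx hy,
    pdy_const_mul hU d hf k hx hy] at e
  simp only [pdy_mul hU (SlitSmooth.coord _) (hf.pdy hU _) k hx hy, pdy_coord,
    Finset.sum_add_distrib, ite_mul, one_mul, zero_mul, Finset.sum_ite_eq', Finset.mem_univ,
    if_true] at e
  rw [Finset.sum_congr rfl fun m _ => by rw [pdy_pdy_comm hU hf k m x hx y hy]]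
  linarith

lemma EulerHom.sum_pdx_pdy (hU : IsOpen U) {d : ℝ} (hf : SlitSmooth U f) (h : EulerHom U d f)
    (k : Fin n) (hx : x ∈ U) (hy : y ≠ 0) :
    ∑ m, y m * _root_.pdx (_root_.pdy f m) k x y = d * _root_.pdx f k x y := by
  have e := SlitEq.pdx hU (f := fun x y => ∑ m, y m * _root_.pdy f m x y)
    (g := fun x y => d * f x y) h k x hx y hy
  rw [pdx_sum hU (fun m => (SlitSmooth.coord m).mul (hf.pdy hU m)) k hx hy,
    pdx_const_mul hU d hf k hx hy] at e
  rw [← e]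
  refine Finset.sum_congr rfl fun m _ => ?_
  rw [pdx_mul hU (SlitSmooth.coord m) (hf.pdy hU m) k hx hy, pdx_fiber (fun y => y m)]
  ring

lemma eulerHom_of_homogeneous (hU : IsOpen U) (hf : SlitSmooth U f) {d : ℕ}
    (h : ∀ (x y : Vec n) (lam : ℝ), 0 < lam → f x (lam • y) = lam ^ d * f x y) :
    EulerHom U d f := by
  intro x hx y hy
  have hd := (hf.differentiableAt_right hU hx hy).hasFDerivAt
  have hl : HasDerivAt (fun t : ℝ => t • y) y 1 := by
    simpa using (hasDerivAt_id (1 : ℝ)).smul_const y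
  have hd' : HasFDerivAt (fun y' => f x y') (fderiv ℝ (fun y' => f x y') y) ((1 : ℝ) • y) := by
    rwa [one_smul]
  have h1 := hd'.comp_hasDerivAt (1 : ℝ) hl
  have h2 : HasDerivAt (fun t : ℝ => t ^ d * f x y) (d * f x y) 1 := by
    simpa using (hasDerivAt_pow d (1 : ℝ)).mul_const (f x y)
  have h3 : ((fun y' => f x y') ∘ fun t : ℝ => t • y) =ᶠ[nhds 1] fun t => t ^ d * f x y := by
    filter_upwards [lt_mem_nhds (zero_lt_one' ℝ)] with t ht using h x y t ht
  rw [← h1.unique (h2.congr_of_eventuallyEq h3)]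
  have := LinearMap.pi_apply_eq_sum_univ (fderiv ℝ (fun y' => f x y') y).toLinearMap y
  simp only [ContinuousLinearMap.coe_coe, smul_eq_mul] at this
  rw [this]
  refine Finset.sum_congr rfl fun m _ => ?_
  unfold _root_.pdy
  congr 2
  ext i
  simp [Pi.single_apply, eq_comm]

end SlitCalculus

section SprayCurvature

variable {U : Set (Vec n)} {G : Fin n → Vec n → Vec n → ℝ} {x y : Vec n}

lemma SlitSmooth.nc (hU : IsOpen U) (hG : ∀ i, SlitSmooth U (G i)) (i j : Fin n) :
    SlitSmooth U (Nc G i j) := (hG i).pdy hU j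

lemma SlitSmooth.ga (hU : IsOpen U) (hG : ∀ i, SlitSmooth U (G i)) (i j k : Fin n) :
    SlitSmooth U (Ga G i j k) := (SlitSmooth.nc hU hG i j).pdy hU k

lemma Ga_symm (hU : IsOpen U) (hG : ∀ i, SlitSmooth U (G i)) (i j k : Fin n) :
    SlitEq U (Ga G i j k) (Ga G i k j) := pdy_pdy_comm hU (hG i) j k

lemma sum_Nc_mul (hE : ∀ i, EulerHom U 2 (G i)) (i : Fin n) (hx : x ∈ U) (hy : y ≠ 0) :
    ∑ j, y j * Nc G i j x y = 2 * G i x y := hE i x hx y hy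

lemma eulerHom_Nc (hU : IsOpen U) (hG : ∀ i, SlitSmooth U (G i)) (hE : ∀ i, EulerHom U 2 (G i))
    (i j : Fin n) : EulerHom U 1 (Nc G i j) := by
  have h := (hE i).pdy hU (hG i) j
  norm_num at h
  exact h

lemma sum_Ga_mul (hU : IsOpen U) (hG : ∀ i, SlitSmooth U (G i)) (hE : ∀ i, EulerHom U 2 (G i))
    (i j : Fin n) (hx : x ∈ U) (hy : y ≠ 0) : ∑ l, y l * Ga G i j l x y = Nc G i j x y := by
  simpa [Ga] using eulerHom_Nc hU hG hE i j x hx y hy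

lemma sum_hd_Ga_mul (hU : IsOpen U) (hG : ∀ i, SlitSmooth U (G i))
    (hE : ∀ i, EulerHom U 2 (G i)) (i j k : Fin n) (hx : x ∈ U) (hy : y ≠ 0) :
    ∑ l, y l * hd G (Ga G i j l) k x y = pdx (Nc G i j) k x y := by
  have h0 : ∀ m, ∑ l, y l * pdy (Ga G i j l) m x y = 0 := fun m => by
    have h := (eulerHom_Nc hU hG hE i j).pdy hU (SlitSmooth.nc hU hG i j) m x hx y hy
    rw [sub_self, zero_mul] at h
    rw [← h]
    exact Finset.sum_congr rfl fun l _ => congrArg (y l * ·)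
      (pdy_pdy_comm hU (SlitSmooth.nc hU hG i j) l m x hx y hy)
  have h1 : ∑ l, y l * pdx (Ga G i j l) k x y = pdx (Nc G i j) k x y := by
    have h := (eulerHom_Nc hU hG hE i j).sum_pdx_pdy hU (SlitSmooth.nc hU hG i j) k hx hy
    rwa [one_mul] at h
  simp only [hd, mul_sub, Finset.sum_sub_distrib, h1, Finset.mul_sum]
  rw [Finset.sum_comm, sub_eq_self]
  refine Finset.sum_eq_zero fun m _ => ?_
  rw [← mul_zero (Nc G m k x y), ← h0 m, Finset.mul_sum]
  exact Finset.sum_congr rfl fun l _ => by ring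

lemma hd_congr (hU : IsOpen U) {f g : Vec n → Vec n → ℝ} (h : SlitEq U f g) (k : Fin n) :
    SlitEq U (hd G f k) (hd G g k) := by
  intro x hx y hy
  simp only [hd, h.pdx hU k x hx y hy, fun m => h.pdy m x hx y hy]

/-- The Riemann curvature in terms of the spray coefficients,
`Rⁱ_k = 2 ∂Gⁱ/∂x^k − y^j ∂Nⁱ_k/∂x^j + 2 G^j Γⁱ_{kj} − Nⁱ_j N^j_k`. -/
lemma Riem2_eq (hU : IsOpen U) (hG : ∀ i, SlitSmooth U (G i)) (hE : ∀ i, EulerHom U 2 (G i))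
    (i k : Fin n) :
    SlitEq U (Riem2 G i k) fun x y =>
      2 * pdx (G i) k x y - ∑ j, y j * pdx (Nc G i k) j x y
        + 2 * ∑ j, G j x y * Ga G i k j x y - ∑ j, Nc G i j x y * Nc G j k x y := by
  intro x hx y hy
  have e1 : ∑ j, ∑ l, y j * hd G (Ga G i j l) k x y * y l = 2 * pdx (G i) k x y := by
    rw [← (hE i).sum_pdx_pdy hU (hG i) k hx hy]
    refine Finset.sum_congr rfl fun j _ => ?_
    change _ = y j * pdx (Nc G i j) k x y
    rw [← sum_hd_Ga_mul hU hG hE i j k hx hy, Finset.mul_sum]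
    exact Finset.sum_congr rfl fun l _ => by ring
  have e2 : ∑ j, ∑ l, y j * hd G (Ga G i j k) l x y * y l = ∑ l, y l * pdx (Nc G i k) l x y := by
    rw [Finset.sum_comm]
    refine Finset.sum_congr rfl fun l _ => ?_
    rw [← sum_hd_Ga_mul hU hG hE i k l hx hy, Finset.mul_sum]
    exact Finset.sum_congr rfl fun j _ => by
      rw [hd_congr hU (Ga_symm hU hG i j k) l x hx y hy]; ring
  have e3 : ∑ j, ∑ l, y j * (∑ s, Ga G i k s x y * Ga G s j l x y) * y l
      = 2 * ∑ j, G j x y * Ga G i k j x y := by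
    have h : ∀ s, ∑ j, ∑ l, y j * Ga G s j l x y * y l = 2 * G s x y := fun s => by
      rw [← sum_Nc_mul hE s hx hy]
      refine Finset.sum_congr rfl fun j _ => ?_
      rw [← sum_Ga_mul hU hG hE s j hx hy, Finset.mul_sum]
      exact Finset.sum_congr rfl fun l _ => by ring
    rw [Finset.mul_sum]
    simp only [← mul_assoc, ← h, Finset.sum_mul, Finset.mul_sum]
    rw [Finset.sum_comm_cycle]
    exact Finset.sum_congr rfl fun s _ => Finset.sum_congr rfl fun j _ =>
      Finset.sum_congr rfl fun l _ => by ring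
  have e4 : ∑ j, ∑ l, y j * (∑ s, Ga G s j k x y * Ga G i l s x y) * y l
      = ∑ j, Nc G i j x y * Nc G j k x y := by
    have h : ∀ s, Nc G i s x y * Nc G s k x y
        = ∑ j, ∑ l, y j * (Ga G s j k x y * Ga G i l s x y) * y l := fun s => by
      rw [← sum_Ga_mul hU hG hE i s hx hy, ← sum_Ga_mul hU hG hE s k hx hy, mul_comm,
        Finset.sum_mul_sum]
      exact Finset.sum_congr rfl fun j _ => Finset.sum_congr rfl fun l _ => by
        rw [Ga_symm hU hG s k j x hx y hy, Ga_symm hU hG i s l x hx y hy]; ring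
    simp only [h, Finset.sum_mul, Finset.mul_sum]
    rw [Finset.sum_comm_cycle]
  beta_reduce
  rw [← e1, ← e2, ← e3, ← e4]
  simp only [Riem2, Riem4, Finset.sum_sub_distrib, mul_add, mul_sub, add_mul, sub_mul,
    Finset.sum_add_distrib]
  ring

end SprayCurvature

section ChiCurvature

variable {U : Set (Vec n)} {G : Fin n → Vec n → Vec n → ℝ} {x y : Vec n}

lemma pdy_Riem2 (hU : IsOpen U) (hG : ∀ i, SlitSmooth U (G i)) (hE : ∀ i, EulerHom U 2 (G i))
    (i k l : Fin n) (hx : x ∈ U) (hy : y ≠ 0) :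
    pdy (Riem2 G i k) l x y =
      2 * pdx (Nc G i l) k x y
        - (pdx (Nc G i k) l x y + ∑ j, y j * pdx (Ga G i k l) j x y)
        + 2 * ∑ j, (Nc G j l x y * Ga G i k j x y + G j x y * pdy (Ga G i k j) l x y)
        - ∑ j, (Ga G i j l x y * Nc G j k x y + Nc G i j x y * Ga G j k l x y) := by
  have hN := SlitSmooth.nc hU hG
  have hΓ := SlitSmooth.ga hU hG
  have s1 : SlitSmooth U fun x y => 2 * pdx (G i) k x y :=
    (SlitSmooth.const 2).mul ((hG i).pdx hU k)
  have t2 : ∀ j, SlitSmooth U fun x y => y j * pdx (Nc G i k) j x y :=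
    fun j => (SlitSmooth.coord j).mul ((hN i k).pdx hU j)
  have t3 : ∀ j, SlitSmooth U fun x y => G j x y * Ga G i k j x y :=
    fun j => (hG j).mul (hΓ i k j)
  have t4 : ∀ j, SlitSmooth U fun x y => Nc G i j x y * Nc G j k x y :=
    fun j => (hN i j).mul (hN j k)
  have s3 : SlitSmooth U fun x y => 2 * ∑ j, G j x y * Ga G i k j x y :=
    (SlitSmooth.const 2).mul (SlitSmooth.sum t3)
  rw [(Riem2_eq hU hG hE i k).pdy l x hx y hy,
    pdy_sub hU ((s1.sub (SlitSmooth.sum t2)).add s3) (SlitSmooth.sum t4) l hx hy,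
    pdy_add hU (s1.sub (SlitSmooth.sum t2)) s3 l hx hy,
    pdy_sub hU s1 (SlitSmooth.sum t2) l hx hy,
    pdy_const_mul hU 2 ((hG i).pdx hU k) l hx hy,
    pdy_const_mul hU 2 (SlitSmooth.sum t3) l hx hy,
    pdy_sum hU t2 l hx hy, pdy_sum hU t3 l hx hy, pdy_sum hU t4 l hx hy,
    pdy_pdx_comm hU (hG i) k l x hx y hy]
  have e2 : ∑ j, pdy (fun x y => y j * pdx (Nc G i k) j x y) l x y
      = pdx (Nc G i k) l x y + ∑ j, y j * pdx (Ga G i k l) j x y := by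
    simp only [pdy_mul hU (SlitSmooth.coord _) ((hN i k).pdx hU _) l hx hy, pdy_coord,
      pdy_pdx_comm hU (hN i k) _ l x hx y hy, Finset.sum_add_distrib, ite_mul, one_mul, zero_mul,
      Finset.sum_ite_eq', Finset.mem_univ, if_true]
    rfl
  rw [e2]
  simp only [pdy_mul hU (hG _) (hΓ _ _ _) l hx hy, pdy_mul hU (hN _ _) (hN _ _) l hx hy]
  rfl

lemma SlitSmooth.piG (hU : IsOpen U) (hG : ∀ i, SlitSmooth U (G i)) : SlitSmooth U (PiG G) :=
  SlitSmooth.sum fun m => SlitSmooth.nc hU hG m m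

lemma pdy_PiG (hU : IsOpen U) (hG : ∀ i, SlitSmooth U (G i)) (k : Fin n) :
    SlitEq U (pdy (PiG G) k) fun x y => ∑ m, Ga G m m k x y :=
  fun _ hx _ hy => pdy_sum hU (fun m => SlitSmooth.nc hU hG m m) k hx hy

/-- `χ_k = ½ (y^j Π_{·k;x^j} − 2 G^j Π_{·k·j} − Π_{;x^k})`. -/
lemma chi_eq (hU : IsOpen U) (hG : ∀ i, SlitSmooth U (G i)) (hE : ∀ i, EulerHom U 2 (G i))
    (k : Fin n) (hx : x ∈ U) (hy : y ≠ 0) :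
    chi G k x y = 1 / 2 * (∑ j, y j * pdx (pdy (PiG G) k) j x y
      - 2 * ∑ j, G j x y * pdy (pdy (PiG G) k) j x y - pdx (PiG G) k x y) := by
  have hN := SlitSmooth.nc hU hG
  have hΓ := SlitSmooth.ga hU hG
  have eX : pdx (PiG G) k x y = ∑ m, pdx (Nc G m m) k x y :=
    pdx_sum hU (fun m => hN m m) k hx hy
  have eZ : ∀ j, pdx (pdy (PiG G) k) j x y = ∑ m, pdx (Ga G m m k) j x y := fun j => by
    rw [(pdy_PiG hU hG k).pdx hU j x hx y hy, pdx_sum hU (fun m => hΓ m m k) j hx hy]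
  have eW : ∀ j, pdy (pdy (PiG G) k) j x y = ∑ m, pdy (Ga G m m k) j x y := fun j => by
    rw [(pdy_PiG hU hG k).pdy j x hx y hy, pdy_sum hU (fun m => hΓ m m k) j hx hy]
  have f1 : ∀ m j, pdx (Ga G m k m) j x y = pdx (Ga G m m k) j x y := fun m j =>
    (Ga_symm hU hG m k m).pdx hU j x hx y hy
  have f2 : ∀ m j, pdy (Ga G m k j) m x y = pdy (Ga G m m k) j x y := fun m j =>
    (pdy_pdy_comm hU (hN m k) j m x hx y hy).trans ((Ga_symm hU hG m k m).pdy j x hx y hy)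
  have f3 : ∀ m j, pdy (Ga G m m j) k x y = pdy (Ga G m m k) j x y := fun m j =>
    pdy_pdy_comm hU (hN m m) j k x hx y hy
  have g1 : ∑ m, ∑ j, Nc G m j x y * Ga G j k m x y = ∑ m, ∑ j, Nc G j m x y * Ga G m k j x y :=
    Finset.sum_comm
  have g2 : ∀ m j, Ga G m j m x y = Ga G m m j x y := fun m j => Ga_symm hU hG m j m x hx y hy
  have g3 : ∀ m j, Ga G m j k x y = Ga G m k j x y := fun m j => Ga_symm hU hG m j k x hx y hy
  have eA : ∑ m, pdy (Riem2 G m k) m x y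
      = 2 * ∑ m, pdx (Nc G m m) k x y - ∑ m, pdx (Nc G m k) m x y
        - ∑ m, ∑ j, y j * pdx (Ga G m m k) j x y
        + ∑ m, ∑ j, Nc G j m x y * Ga G m k j x y
        + 2 * ∑ m, ∑ j, G j x y * pdy (Ga G m m k) j x y
        - ∑ m, ∑ j, Nc G j k x y * Ga G m m j x y := by
    simp only [pdy_Riem2 hU hG hE _ _ _ hx hy, f1, f2, g2, Finset.sum_add_distrib,
      Finset.sum_sub_distrib, ← Finset.mul_sum, g1, mul_comm (Ga G _ _ _ x y), mul_add]
    ring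
  have eB : ∑ m, pdy (Riem2 G m m) k x y
      = 2 * ∑ m, pdx (Nc G m k) m x y - ∑ m, pdx (Nc G m m) k x y
        - ∑ m, ∑ j, y j * pdx (Ga G m m k) j x y
        + 2 * ∑ m, ∑ j, Nc G j k x y * Ga G m m j x y
        + 2 * ∑ m, ∑ j, G j x y * pdy (Ga G m m k) j x y
        - 2 * ∑ m, ∑ j, Nc G j m x y * Ga G m k j x y := by
    simp only [pdy_Riem2 hU hG hE _ _ _ hx hy, f3, g3, Finset.sum_add_distrib,
      Finset.sum_sub_distrib, ← Finset.mul_sum, g1, mul_comm (Ga G _ _ _ x y), mul_add]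
    ring
  have h1 : ∑ j, y j * ∑ m, pdx (Ga G m m k) j x y
      = ∑ m, ∑ j, y j * pdx (Ga G m m k) j x y := by
    simp only [Finset.mul_sum]
    exact Finset.sum_comm
  have h2 : ∑ j, G j x y * ∑ m, pdy (Ga G m m k) j x y
      = ∑ m, ∑ j, G j x y * pdy (Ga G m m k) j x y := by
    simp only [Finset.mul_sum]
    exact Finset.sum_comm
  simp only [chi, eX, eZ, eW, eA, eB, h1, h2]
  ring

end ChiCurvature

section ProjectiveChange

variable {U : Set (Vec n)} {G : Fin n → Vec n → Vec n → ℝ} {P : Vec n → Vec n → ℝ} {x y : Vec n}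

lemma Nc_projective (hU : IsOpen U) (hG : ∀ i, SlitSmooth U (G i)) (hP : SlitSmooth U P)
    (i k : Fin n) :
    SlitEq U (Nc (fun i x y => G i x y - P x y * y i) i k) fun x y =>
      Nc G i k x y - (pdy P k x y * y i + P x y * if i = k then 1 else 0) := by
  intro x hx y hy
  beta_reduce
  rw [← pdy_coord (x := x) (y := y) i k, ← pdy_mul hU hP (SlitSmooth.coord i) k hx hy]
  exact pdy_sub hU (hG i) (hP.mul (SlitSmooth.coord i)) k hx hy

lemma Ga_projective (hU : IsOpen U) (hG : ∀ i, SlitSmooth U (G i)) (hP : SlitSmooth U P)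
    (i k j : Fin n) (hx : x ∈ U) (hy : y ≠ 0) :
    Ga (fun i x y => G i x y - P x y * y i) i k j x y =
      Ga G i k j x y - (pdy (pdy P k) j x y * y i + pdy P k x y * (if i = j then 1 else 0)
        + pdy P j x y * if i = k then 1 else 0) := by
  have h1 := (hP.pdy hU k).mul (SlitSmooth.coord i)
  have h2 := hP.mul (SlitSmooth.const (if i = k then 1 else 0))
  refine ((Nc_projective hU hG hP i k).pdy j x hx y hy).trans ?_
  rw [pdy_sub hU (SlitSmooth.nc hU hG i k) (h1.add h2) j hx hy, pdy_add hU h1 h2 j hx hy,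
    pdy_mul hU (hP.pdy hU k) (SlitSmooth.coord i) j hx hy,
    pdy_mul hU hP (SlitSmooth.const (if i = k then 1 else 0)) j hx hy, pdy_coord, pdy_const]
  simp [Ga]

lemma pdx_Nc_projective (hU : IsOpen U) (hG : ∀ i, SlitSmooth U (G i)) (hP : SlitSmooth U P)
    (i k j : Fin n) (hx : x ∈ U) (hy : y ≠ 0) :
    pdx (Nc (fun i x y => G i x y - P x y * y i) i k) j x y =
      pdx (Nc G i k) j x y
        - (pdx (pdy P k) j x y * y i + pdx P j x y * if i = k then 1 else 0) := by
  have h1 := (hP.pdy hU k).mul (SlitSmooth.coord i)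
  have h2 := hP.mul (SlitSmooth.const (if i = k then 1 else 0))
  rw [(Nc_projective hU hG hP i k).pdx hU j x hx y hy,
    pdx_sub hU (SlitSmooth.nc hU hG i k) (h1.add h2) j hx hy, pdx_add hU h1 h2 j hx hy,
    pdx_mul hU (hP.pdy hU k) (SlitSmooth.coord i) j hx hy,
    pdx_mul hU hP (SlitSmooth.const (if i = k then 1 else 0)) j hx hy,
    pdx_fiber (fun y => y i), pdx_fiber (fun _ => if i = k then 1 else 0)]
  simp

/-- The Riemann curvature of the projectively related spray `Gⁱ − P yⁱ`. -/
lemma Riem2_projective (hU : IsOpen U) (hG : ∀ i, SlitSmooth U (G i))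
    (hE : ∀ i, EulerHom U 2 (G i)) (hP : SlitSmooth U P) (hPE : EulerHom U 1 P)
    (i k : Fin n) (hx : x ∈ U) (hy : y ≠ 0) :
    Riem2 (fun i x y => G i x y - P x y * y i) i k x y =
      Riem2 G i k x y
        + (P x y ^ 2 + (∑ j, y j * pdx P j x y - 2 * ∑ j, G j x y * pdy P j x y))
          * (if i = k then 1 else 0)
        + (∑ j, y j * pdx (pdy P k) j x y - 2 * ∑ j, G j x y * pdy (pdy P k) j x y
          + ∑ j, Nc G j k x y * pdy P j x y - 2 * pdx P k x y - P x y * pdy P k x y) * y i := by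
  have hG' : ∀ i, SlitSmooth U fun x y => G i x y - P x y * y i := fun i =>
    (hG i).sub (hP.mul (SlitSmooth.coord i))
  have hE' : ∀ i, EulerHom U 2 fun x y => G i x y - P x y * y i := by
    intro i x hx y hy
    have h1 := hE i x hx y hy
    have h2 := hPE x hx y hy
    simp only [pdy_sub hU (hG i) (hP.mul (SlitSmooth.coord i)) _ hx hy,
      pdy_mul hU hP (SlitSmooth.coord i) _ hx hy, pdy_coord, mul_sub, mul_add,
      Finset.sum_sub_distrib, Finset.sum_add_distrib, ← mul_assoc, ← Finset.sum_mul, h1, h2,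
      mul_ite, mul_one, mul_zero, Finset.sum_ite_eq, Finset.mem_univ, if_true]
    ring
  rw [Riem2_eq hU hG' hE' i k x hx y hy, Riem2_eq hU hG hE i k x hx y hy]
  have eP1 : ∑ j, y j * pdy P j x y = P x y := by rw [hPE x hx y hy, one_mul]
  have eP2 : ∑ j, y j * pdy (pdy P k) j x y = 0 := by
    rw [hPE.pdy hU hP k x hx y hy]; ring
  have eG : ∑ j, y j * Nc G i j x y = 2 * G i x y := sum_Nc_mul hE i hx hy
  have eN : ∑ j, y j * Ga G i k j x y = Nc G i k x y := sum_Ga_mul hU hG hE i k hx hy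
  have r1 : pdx (fun x y => G i x y - P x y * y i) k x y = pdx (G i) k x y - pdx P k x y * y i := by
    rw [pdx_sub hU (hG i) (hP.mul (SlitSmooth.coord i)) k hx hy,
      pdx_mul hU hP (SlitSmooth.coord i) k hx hy, pdx_fiber (fun y => y i)]
    ring
  have r2 : ∑ j, y j * (pdx (Nc G i k) j x y
        - (pdx (pdy P k) j x y * y i + pdx P j x y * if i = k then 1 else 0))
      = ∑ j, y j * pdx (Nc G i k) j x y - (∑ j, y j * pdx (pdy P k) j x y) * y i
        - (∑ j, y j * pdx P j x y) * if i = k then 1 else 0 := by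
    simp only [Finset.sum_mul, ← Finset.sum_sub_distrib]
    exact Finset.sum_congr rfl fun j _ => by ring
  have r3 : ∑ j, (G j x y - P x y * y j) * (Ga G i k j x y - (pdy (pdy P k) j x y * y i
        + pdy P k x y * (if i = j then 1 else 0) + pdy P j x y * if i = k then 1 else 0))
      = ∑ j, G j x y * Ga G i k j x y - (∑ j, G j x y * pdy (pdy P k) j x y) * y i
        - G i x y * pdy P k x y - (∑ j, G j x y * pdy P j x y) * (if i = k then 1 else 0)
        - P x y * (∑ j, y j * Ga G i k j x y - (∑ j, y j * pdy (pdy P k) j x y) * y i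
        - y i * pdy P k x y - (∑ j, y j * pdy P j x y) * if i = k then 1 else 0) := by
    have d1 : G i x y * pdy P k x y = ∑ j, G j x y * pdy P k x y * if i = j then 1 else 0 := by
      simp
    have d2 : y i * pdy P k x y = ∑ j, y j * pdy P k x y * if i = j then 1 else 0 := by simp
    rw [d1, d2]
    simp only [Finset.sum_mul, ← Finset.sum_sub_distrib, Finset.mul_sum]
    exact Finset.sum_congr rfl fun j _ => by ring
  have r4 : ∑ j, (Nc G i j x y - (pdy P j x y * y i + P x y * if i = j then 1 else 0))
        * (Nc G j k x y - (pdy P k x y * y j + P x y * if j = k then 1 else 0))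
      = ∑ j, Nc G i j x y * Nc G j k x y - (∑ j, y j * Nc G i j x y) * pdy P k x y
        - P x y * Nc G i k x y - (∑ j, Nc G j k x y * pdy P j x y) * y i
        + (∑ j, y j * pdy P j x y) * pdy P k x y * y i + P x y * pdy P k x y * y i
        - P x y * Nc G i k x y + P x y * pdy P k x y * y i
        + P x y ^ 2 * if i = k then 1 else 0 := by
    have d1 : Nc G i k x y = ∑ j, Nc G i j x y * if j = k then 1 else 0 := by simp
    have d2 : Nc G i k x y = ∑ j, Nc G j k x y * if i = j then 1 else 0 := by simp
    have d3 : pdy P k x y = ∑ j, pdy P j x y * if j = k then 1 else 0 := by simp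
    have d4 : y i = ∑ j, y j * if i = j then 1 else 0 := by simp
    have d5 : (if i = k then 1 else 0 : ℝ)
        = ∑ j, (if i = j then 1 else 0) * if j = k then 1 else 0 := by simp
    calc _ = ∑ j, Nc G i j x y * Nc G j k x y - (∑ j, y j * Nc G i j x y) * pdy P k x y
        - P x y * (∑ j, Nc G i j x y * if j = k then 1 else 0)
        - (∑ j, Nc G j k x y * pdy P j x y) * y i
        + (∑ j, y j * pdy P j x y) * pdy P k x y * y i
        + P x y * (∑ j, pdy P j x y * if j = k then 1 else 0) * y i
        - P x y * (∑ j, Nc G j k x y * if i = j then 1 else 0)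
        + P x y * pdy P k x y * (∑ j, y j * if i = j then 1 else 0)
        + P x y ^ 2 * (∑ j, (if i = j then 1 else 0) * if j = k then 1 else 0) := by
          simp only [Finset.sum_mul, ← Finset.sum_sub_distrib, ← Finset.sum_add_distrib,
            Finset.mul_sum]
          exact Finset.sum_congr rfl fun j _ => by ring
      _ = _ := by rw [← d1, ← d2, ← d3, ← d4, ← d5]
  simp only [r1, pdx_Nc_projective hU hG hP i k _ hx hy, Ga_projective hU hG hP i k _ hx hy,
    Nc_projective hU hG hP _ _ x hx y hy, r2, r3, r4, eP1, eP2, eG, eN]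
  ring

end ProjectiveChange

section SCurvature

variable {U : Set (Vec n)} {G : Fin n → Vec n → Vec n → ℝ} {σ : Vec n → ℝ}
  {f : Vec n → Vec n → ℝ} {x y : Vec n}

lemma IsVolumeForm.slitSmooth_log (hσ : IsVolumeForm U σ) :
    SlitSmooth U fun x _ => Real.log (σ x) :=
  (hσ.1.log fun x hx => (hσ.2 x hx).ne').comp contDiff_fst.contDiffOn fun _ hp => hp.1

lemma SlitSmooth.scurv (hU : IsOpen U) (hG : ∀ i, SlitSmooth U (G i)) (hσ : IsVolumeForm U σ) :
    SlitSmooth U (Scurv G σ) :=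
  (SlitSmooth.piG hU hG).sub <| SlitSmooth.sum fun m =>
    (SlitSmooth.coord m).mul (hσ.slitSmooth_log.pdx hU m)

lemma pdy_base (h : Vec n → ℝ) (k : Fin n) : pdy (fun x _ => h x) k x y = 0 := by
  simp [pdy]

lemma pdy_Scurv (hU : IsOpen U) (hG : ∀ i, SlitSmooth U (G i)) (hσ : IsVolumeForm U σ)
    (k : Fin n) :
    SlitEq U (pdy (Scurv G σ) k) fun x y =>
      pdy (PiG G) k x y - pd (fun x' => Real.log (σ x')) k x := by
  intro x hx y hy
  have hL : ∀ m, SlitSmooth U fun x _ => pd (fun x' => Real.log (σ x')) m x :=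
    hσ.slitSmooth_log.pdx hU
  have hyL := fun m => (SlitSmooth.coord m).mul (hL m)
  refine (pdy_sub hU (SlitSmooth.piG hU hG) (SlitSmooth.sum hyL) k hx hy).trans ?_
  rw [pdy_sum hU hyL k hx hy]
  simp [pdy_mul hU (SlitSmooth.coord _) (hL _) k hx hy, pdy_coord, pdy_base]

lemma eulerHom_Scurv (hU : IsOpen U) (hG : ∀ i, SlitSmooth U (G i))
    (hE : ∀ i, EulerHom U 2 (G i)) (hσ : IsVolumeForm U σ) : EulerHom U 1 (Scurv G σ) := by
  intro x hx y hy
  have h : ∑ m, y m * pdy (PiG G) m x y = PiG G x y := by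
    simp only [pdy_PiG hU hG _ x hx y hy, Finset.mul_sum]
    rw [Finset.sum_comm]
    exact Finset.sum_congr rfl fun m _ => sum_Ga_mul hU hG hE m m hx hy
  simp only [pdy_Scurv hU hG hσ _ x hx y hy, mul_sub, Finset.sum_sub_distrib, h, Scurv, one_mul]

/-- `χ_k = ½ (y^j S_{·k;x^j} − 2 G^j S_{·k·j} − S_{;x^k})`. -/
lemma chi_eq_Scurv (hU : IsOpen U) (hG : ∀ i, SlitSmooth U (G i))
    (hE : ∀ i, EulerHom U 2 (G i)) (hσ : IsVolumeForm U σ) (k : Fin n) (hx : x ∈ U)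
    (hy : y ≠ 0) :
    chi G k x y = 1 / 2 * (∑ j, y j * pdx (pdy (Scurv G σ) k) j x y
      - 2 * ∑ j, G j x y * pdy (pdy (Scurv G σ) k) j x y - pdx (Scurv G σ) k x y) := by
  set L : Fin n → Vec n → Vec n → ℝ := fun m x _ => pd (fun x' => Real.log (σ x')) m x with hLdef
  have hlog := hσ.slitSmooth_log
  have hL : ∀ m, SlitSmooth U (L m) := hlog.pdx hU
  have hyL := fun m => (SlitSmooth.coord m).mul (hL m)
  have hPi := SlitSmooth.piG hU hG
  have e1 : ∀ j, pdx (pdy (Scurv G σ) k) j x y = pdx (pdy (PiG G) k) j x y - pdx (L j) k x y :=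
    fun j => by
      rw [(pdy_Scurv hU hG hσ k).pdx hU j x hx y hy]
      refine (pdx_sub hU (hPi.pdy hU k) (hL k) j hx hy).trans ?_
      exact congrArg _ (pdx_pdx_comm hU hlog k j x hx y hy)
  have e2 : ∀ j, pdy (pdy (Scurv G σ) k) j x y = pdy (pdy (PiG G) k) j x y := fun j => by
    rw [(pdy_Scurv hU hG hσ k).pdy j x hx y hy]
    refine (pdy_sub hU (hPi.pdy hU k) (hL k) j hx hy).trans ?_
    rw [hLdef, pdy_base, sub_zero]
  have e3 : pdx (Scurv G σ) k x y = pdx (PiG G) k x y - ∑ j, y j * pdx (L j) k x y := by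
    refine (pdx_sub hU hPi (SlitSmooth.sum hyL) k hx hy).trans ?_
    rw [pdx_sum hU hyL k hx hy]
    simp only [pdx_mul hU (SlitSmooth.coord _) (hL _) k hx hy, pdx_fiber (fun y => y _), zero_mul,
      zero_add]
  rw [chi_eq hU hG hE k hx hy, e3]
  simp only [e1, e2, mul_sub, Finset.sum_sub_distrib]
  ring

lemma sum_mul_hd (hE : ∀ i, EulerHom U 2 (G i)) :
    SlitEq U (fun x y => ∑ m, y m * hd G f m x y) fun x y =>
      ∑ m, y m * pdx f m x y - 2 * ∑ m, G m x y * pdy f m x y := by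
  intro x hx y hy
  simp only [hd, mul_sub, Finset.sum_sub_distrib, Finset.mul_sum]
  rw [Finset.sum_comm]
  congr 1
  refine Finset.sum_congr rfl fun m _ => ?_
  rw [← mul_assoc, ← sum_Nc_mul hE m hx hy, Finset.sum_mul]
  exact Finset.sum_congr rfl fun j _ => by ring

lemma pdy_sum_mul_hd (hU : IsOpen U) (hG : ∀ i, SlitSmooth U (G i))
    (hE : ∀ i, EulerHom U 2 (G i)) (hf : SlitSmooth U f) (k : Fin n) (hx : x ∈ U) (hy : y ≠ 0) :
    pdy (fun x y => ∑ m, y m * hd G f m x y) k x y =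
      pdx f k x y + ∑ m, y m * pdx (pdy f k) m x y
        - 2 * (∑ m, Nc G m k x y * pdy f m x y + ∑ m, G m x y * pdy (pdy f k) m x y) := by
  have s1 := fun m => (SlitSmooth.coord m).mul (hf.pdx hU m)
  have s2 := fun m => (hG m).mul (hf.pdy hU m)
  rw [(sum_mul_hd hE).pdy k x hx y hy,
    pdy_sub hU (SlitSmooth.sum s1) ((SlitSmooth.const 2).mul (SlitSmooth.sum s2)) k hx hy,
    pdy_const_mul hU 2 (SlitSmooth.sum s2) k hx hy, pdy_sum hU s1 k hx hy, pdy_sum hU s2 k hx hy]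
  simp only [pdy_mul hU (SlitSmooth.coord _) (hf.pdx hU _) k hx hy,
    pdy_mul hU (hG _) (hf.pdy hU _) k hx hy, pdy_coord, pdy_pdx_comm hU hf _ k x hx y hy,
    pdy_pdy_comm hU hf _ k x hx y hy, Finset.sum_add_distrib, ite_mul, one_mul, zero_mul,
    Finset.sum_ite_eq', Finset.mem_univ, if_true, Nc]

end SCurvature

/-- the Riemann curvature of the associated spray `Ĝ` is
`R̂ⁱ_k = Rⁱ_k + τ δⁱ_k − (1/2) τ_{·k} yⁱ + (3 χ_k/(n+1)) yⁱ` with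
`τ := (S/(n+1))² + (1/(n+1)) S_{|m} y^m`. -/
theorem Riemann_curvature_of_associated_spray
    {n : ℕ} (hn : 2 ≤ n) (U : Set (Vec n)) (hU : IsOpen U)
    (G : Fin n → Vec n → Vec n → ℝ) (hG : IsSpray U G)
    (σ : Vec n → ℝ) (hσ : IsVolumeForm U σ) :
    ∀ x ∈ U, ∀ y : Vec n, y ≠ 0 → ∀ i k,
      Riem2 (Ghat G σ) i k x y
        = Riem2 G i k x y
          + ((Scurv G σ x y / ((n : ℝ) + 1)) ^ 2
              + (1 / ((n : ℝ) + 1)) * ∑ m, y m * hd G (Scurv G σ) m x y)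
            * (if i = k then 1 else 0)
          - (1 / 2) * pdy (fun x' y' =>
              (Scurv G σ x' y' / ((n : ℝ) + 1)) ^ 2
                + (1 / ((n : ℝ) + 1)) * ∑ m, y' m * hd G (Scurv G σ) m x' y') k x y
            * y i
          + (3 * chi G k x y / ((n : ℝ) + 1)) * y i := by
  intro x hx y hy i k
  have hGs : ∀ i, SlitSmooth U (G i) := hG.1
  have hE : ∀ i, EulerHom U 2 (G i) := fun i => by
    simpa using eulerHom_of_homogeneous hU (hGs i) (hG.2 i)
  have hS : SlitSmooth U (Scurv G σ) := SlitSmooth.scurv hU hGs hσ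
  have hSE := eulerHom_Scurv hU hGs hE hσ
  set S := Scurv G σ with hSdef
  set c : ℝ := 1 / ((n : ℝ) + 1) with hc
  have hdiv : ∀ x y, S x y / ((n : ℝ) + 1) = c * S x y := fun x y => by rw [hc]; ring
  have hP : SlitSmooth U fun x y => c * S x y := (SlitSmooth.const c).mul hS
  have p1 : ∀ j, SlitEq U (pdy (fun x y => c * S x y) j) fun x y => c * pdy S j x y :=
    fun j x hx y hy => pdy_const_mul hU c hS j hx hy
  have p2 : ∀ j, pdx (fun x y => c * S x y) j x y = c * pdx S j x y :=
    fun j => pdx_const_mul hU c hS j hx hy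
  have p3 : ∀ j, pdx (pdy (fun x y => c * S x y) k) j x y = c * pdx (pdy S k) j x y := fun j => by
    rw [(p1 k).pdx hU j x hx y hy, pdx_const_mul hU c (hS.pdy hU k) j hx hy]
  have p4 : ∀ j, pdy (pdy (fun x y => c * S x y) k) j x y = c * pdy (pdy S k) j x y := fun j => by
    rw [(p1 k).pdy j x hx y hy, pdy_const_mul hU c (hS.pdy hU k) j hx hy]
  have hPE : EulerHom U 1 fun x y => c * S x y := by
    intro x hx y hy
    simp only [p1 _ x hx y hy, mul_left_comm _ c, ← Finset.mul_sum, hSE x hx y hy]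
  have hGhat : Ghat G σ = fun i x y => G i x y - c * S x y * y i := by
    funext i x y
    rw [Ghat, ← hSdef, hdiv]
  have hT : SlitSmooth U fun x y => ∑ m, y m * hd G S m x y :=
    SlitSmooth.sum fun m => (SlitSmooth.coord m).mul <|
      (hS.pdx hU m).sub <| SlitSmooth.sum fun j => (SlitSmooth.nc hU hGs j m).mul (hS.pdy hU j)
  have hτ : pdy (fun x' y' => (c * S x' y') ^ 2 + c * ∑ m, y' m * hd G S m x' y') k x y
      = 2 * c ^ 2 * S x y * pdy S k x y + c * (pdx S k x y + ∑ m, y m * pdx (pdy S k) m x y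
        - 2 * (∑ m, Nc G m k x y * pdy S m x y + ∑ m, G m x y * pdy (pdy S k) m x y)) := by
    simp only [pow_two]
    rw [pdy_add hU (hP.mul hP) ((SlitSmooth.const c).mul hT) k hx hy, pdy_mul hU hP hP k hx hy,
      pdy_const_mul hU c hT k hx hy, p1 k x hx y hy, pdy_sum_mul_hd hU hGs hE hS k hx hy]
    ring
  have hχ : 3 * chi G k x y / ((n : ℝ) + 1) = c * (3 * chi G k x y) := by rw [hc]; ring
  have hSum := sum_mul_hd (f := S) hE x hx y hy
  beta_reduce at hSum
  simp only [hdiv]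
  rw [hτ, hχ, chi_eq_Scurv hU hGs hE hσ k hx hy, ← hSdef, hGhat,
    Riem2_projective hU hGs hE hP hPE i k hx hy, hSum]
  simp only [p1 _ x hx y hy, p2, p3, p4, mul_left_comm _ c, ← Finset.mul_sum]
  ring
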